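/- arXiv:1701.05214 — 2 statements merged into one kernel-verified Lean document; each statement's English description precedes it below -/
import Mathlib

section
/- Let p be an odd prime, q = p^e, and 1 ≤ k ≤ q - 1. If the polynomial A_k(X) = X^k·((X+1)^k − X^k) is a permutation polynomial of F_q, then k is a power of p. -/
namespace MonomialDifference

theorem sub_one_pow_char_sub_one {F : Type*} [Field F] (p : ℕ) [Fact p.Prime] [CharP F p]
    (x : F) :
    (x - 1) ^ (p - 1) = ∑ i ∈ Finset.range p, x ^ i := by
  have hp : 1 < p := (Fact.out : p.Prime).one_lt
  rcases eq_or_ne x 1 with rfl | hx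
  · simp [show p - 1 ≠ 0 by omega]
  · refine mul_right_cancel₀ (sub_ne_zero.2 hx) ?_
    rw [geom_sum_mul, ← pow_succ, Nat.sub_add_cancel hp.le, sub_pow_char (p := p), one_pow]

section PowerSums

variable {F : Type*} [Field F] [Fintype F]

theorem sum_pow_eq_ite {i : ℕ} (hi : i ≠ 0) :
    ∑ x : F, x ^ i = if Fintype.card F - 1 ∣ i then -1 else 0 := by
  classical
  rw [← FiniteField.sum_pow_units F i,
    ← Finset.sum_erase (f := fun x : F => x ^ i) Finset.univ (zero_pow hi)]
  symm
  refine Finset.sum_bij (fun x _ => (x : F)) (fun x _ => by simp)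
    (fun x _ y _ h => Units.ext h) (fun y hy => ?_) (fun x _ => rfl)
  exact ⟨Units.mk0 y (Finset.ne_of_mem_erase hy), Finset.mem_univ _, rfl⟩

theorem pow_eq_pow_of_modEq_card_sub_one {a b : ℕ} (ha : a ≠ 0) (hb : b ≠ 0)
    (h : a ≡ b [MOD Fintype.card F - 1]) (x : F) : x ^ a = x ^ b := by
  rcases eq_or_ne x 0 with rfl | hx
  · rw [zero_pow ha, zero_pow hb]
  · exact pow_eq_pow_of_modEq h (FiniteField.pow_card_sub_one_eq_one x hx)

theorem sum_sub_one_pow_mul_pow {R m : ℕ} (hR : 0 < R) (hR' : R < Fintype.card F - 1)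
    (hm : m = 0 ∨ ¬ Fintype.card F - 1 ∣ m) :
    ∑ z : F, (z - 1) ^ R * z ^ m =
      -((m % (Fintype.card F - 1)).choose (Fintype.card F - 1 - R) : F) := by
  set Q := Fintype.card F - 1 with hQ
  have hlt : m % Q < Q := Nat.mod_lt _ (by omega)
  have hpow (z : F) : z ^ m = z ^ (m % Q) := by
    rcases hm with rfl | hm
    · simp
    · exact pow_eq_pow_of_modEq_card_sub_one (by rintro rfl; simp at hm)
        (fun h => hm (Nat.dvd_of_mod_eq_zero h)) (Nat.mod_modEq m Q).symm z
  simp_rw [hpow]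
  generalize m % Q = c at hlt
  rw [← Equiv.sum_comp (Equiv.addRight (1 : F))]
  simp only [Equiv.coe_addRight, add_sub_cancel_right, add_pow, one_pow, mul_one,
    Finset.mul_sum]
  rw [Finset.sum_comm]
  have hinner (j : ℕ) (hj : j < c + 1) : ∑ x : F, x ^ R * (x ^ j * (c.choose j : F)) =
      if j = Q - R then -(c.choose (Q - R) : F) else 0 := by
    have : ∑ x : F, x ^ R * (x ^ j * (c.choose j : F)) =
        (∑ x : F, x ^ (R + j)) * c.choose j := by
      rw [Finset.sum_mul]
      exact Finset.sum_congr rfl fun x _ => by ring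
    rw [this, sum_pow_eq_ite (by omega), ← hQ]
    have hiff : Q ∣ R + j ↔ j = Q - R := by
      constructor
      · rintro ⟨d, hd⟩
        have : d = 1 := by
          have h1 : d < 2 := by
            by_contra! h
            nlinarith
          have h2 : d ≠ 0 := by rintro rfl; omega
          omega
        subst this
        omega
      · rintro rfl
        exact ⟨1, by omega⟩
    simp only [hiff]
    split_ifs with h
    · rw [h]; ring
    · ring
  rw [Finset.sum_congr rfl fun j hj => hinner j (Finset.mem_range.1 hj), Finset.sum_ite_eq']
  split_ifs with h
  · rfl
  · rw [Nat.choose_eq_zero_of_lt (by rw [Finset.mem_range] at h; omega)]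
    simp

end PowerSums

/-- The power sums of `X ^ k * ((X + 1) ^ k - X ^ k)` with exponents not divisible by `q - 1`
vanish, rewritten through the substitution `x = (z ^ n - 1)⁻¹` where `n` is an inverse of `k`
modulo `q - 1`. -/
def VanishingPowerSums (F : Type*) [Field F] [Fintype F] (n : ℕ) : Prop :=
  ∀ t R : ℕ, 0 < R → ¬ Fintype.card F - 1 ∣ t → Fintype.card F - 1 ∣ R + n * t →
    ∑ z : F, (z - 1) ^ R * (z ^ n - 1) ^ (2 * t) = 0

section Permutation

variable {F : Type*} [Field F] [Fintype F]

theorem coprime_of_injective {k : ℕ} (hcard : 2 < Fintype.card F)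
    (h : Function.Injective fun x : F => x ^ k * ((x + 1) ^ k - x ^ k)) (hk : k ≠ 0) :
    k.Coprime (Fintype.card F - 1) := by
  have key (z : F) (hz : z ^ k = 1) : z = 1 := by
    by_contra hne
    have hne' : z - 1 ≠ 0 := sub_ne_zero.2 hne
    have h1 : (z - 1)⁻¹ + 1 = z * (z - 1)⁻¹ := by field_simp; ring
    have := @h (z - 1)⁻¹ 0 (by simp [h1, mul_pow, hz, hk])
    exact hne' (by simpa using this)
  set Q := Fintype.card F - 1 with hQ
  obtain ⟨m, hm⟩ := Nat.gcd_dvd_right k Q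
  obtain ⟨l, hl⟩ := Nat.gcd_dvd_left k Q
  have hall : ∀ x : Fˣ, x ^ m = 1 := fun x => Units.ext <| key _ <| by
    rw [Units.val_pow_eq_pow_val, ← pow_mul, hl, ← mul_assoc, mul_comm m, ← hm, pow_mul,
      FiniteField.pow_card_sub_one_eq_one _ x.ne_zero, one_pow]
  have hdvd := (FiniteField.forall_pow_eq_one_iff F m).1 hall
  have hm0 : 0 < m := Nat.pos_of_ne_zero (by rintro rfl; omega)
  have hle := Nat.le_of_dvd hm0 hdvd
  have hg : 0 < k.gcd Q := Nat.gcd_pos_of_pos_right _ (by omega)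
  have : k.gcd Q * m ≤ 1 * m := by rw [← hm]; omega
  have := Nat.le_of_mul_le_mul_right this hm0
  exact Nat.coprime_iff_gcd_eq_one.2 (by omega)

theorem vanishingPowerSums_of_bijective {k n : ℕ} (hk : k ≠ 0) (hn : n ≠ 0)
    (hkn : n * k ≡ 1 [MOD Fintype.card F - 1])
    (h : Function.Bijective fun x : F => x ^ k * ((x + 1) ^ k - x ^ k)) :
    VanishingPowerSums F n := by
  intro t R hR ht hdvd
  set Q := Fintype.card F - 1 with hQ
  have hroot (z : F) : (z ^ n) ^ k = z := by
    rw [← pow_mul, pow_eq_pow_of_modEq_card_sub_one (mul_ne_zero hn hk) one_ne_zero hkn, pow_one]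
  have hinj : Function.Injective fun z : F => (z ^ n - 1)⁻¹ := fun a b hab => by
    have := congrArg (· ^ k) (sub_left_injective (inv_injective hab))
    simpa only [hroot] using this
  have hbij := h.comp (Finite.injective_iff_bijective.1 hinj)
  have hRQ : ¬ Q ∣ R := fun hRQ => ht <| by
    have h1 : Q ∣ n * t := (Nat.dvd_add_right hRQ).1 hdvd
    have h2 : n * k * t ≡ 1 * t [MOD Q] := hkn.mul_right t
    rw [one_mul] at h2
    refine (h2.dvd_iff dvd_rfl).1 ?_
    rw [mul_right_comm]
    exact h1.mul_right k
  have hsum : ∑ x : F, x ^ R = 0 := by rw [sum_pow_eq_ite hR.ne', if_neg hRQ]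
  rw [← Function.Bijective.sum_comp hbij] at hsum
  rw [← hsum]
  refine Finset.sum_congr rfl fun z _ => ?_
  rcases eq_or_ne z 1 with rfl | hz
  · simp [hR.ne', hk]
  have hy : z ^ n - 1 ≠ 0 := fun h0 => hz <| by
    rw [← hroot z, sub_eq_zero.1 h0, one_pow]
  have hexp : (z ^ n - 1) ^ (2 * t + 2 * k * R) = 1 := by
    have : Q ∣ 2 * t + 2 * k * R := by
      have h1 : n * k * t ≡ 1 * t [MOD Q] := hkn.mul_right t
      rw [one_mul] at h1
      have h2 : 2 * t + 2 * k * R ≡ 2 * k * (R + n * t) [MOD Q] := by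
        calc 2 * t + 2 * k * R ≡ 2 * (n * k * t) + 2 * k * R [MOD Q] :=
              (h1.symm.mul_left 2).add_right _
          _ = 2 * k * (R + n * t) := by ring
      exact (h2.dvd_iff dvd_rfl).2 (hdvd.mul_left _)
    obtain ⟨d, hd⟩ := this
    rw [hd, pow_mul, FiniteField.pow_card_sub_one_eq_one _ hy, one_pow]
  have hx : (z ^ n - 1)⁻¹ + 1 = z ^ n * (z ^ n - 1)⁻¹ := by field_simp; ring
  simp only [Function.comp_apply, hx]
  rw [mul_pow (z ^ n), hroot, ← sub_one_mul, mul_left_comm, ← pow_two, ← pow_mul, mul_pow,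
    ← pow_mul, inv_pow]
  congr 1
  refine eq_inv_of_mul_eq_one_left ?_
  rw [← pow_add, mul_comm k, hexp]

theorem VanishingPowerSums.le_two_mul_div {p n : ℕ} [Fact p.Prime] [CharP F p]
    (hV : VanishingPowerSums F n) (hcop : n.Coprime (Fintype.card F - 1))
    (heven : Even (Fintype.card F - 1)) (h1 : 1 < n) (hn : n < Fintype.card F - 1) :
    p ≤ 2 * ((Fintype.card F - 1) / n) := by
  set Q := Fintype.card F - 1 with hQ
  by_contra! hlt
  set a := Q / n with ha
  have ha0 : 0 < a := Nat.div_pos hn.le (by omega)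
  have hn2 : n ≠ 2 := by
    rintro rfl
    exact absurd (Nat.eq_one_of_dvd_coprimes hcop dvd_rfl heven.two_dvd) (by norm_num)
  have hle : n * a ≤ Q := Nat.mul_div_le Q n
  have hne : n * a ≠ Q := fun h =>
    h1.ne' (Nat.eq_one_of_dvd_coprimes hcop dvd_rfl ⟨a, h.symm⟩)
  have hgt : Q < n * (a + 1) := Nat.lt_mul_div_succ Q (by omega)
  have h3 : 3 * a ≤ n * a := Nat.mul_le_mul_right a (by omega)
  have hpos : 0 < n * a := Nat.mul_pos (by omega) ha0
  have hsum := hV a (Q - n * a) (by omega) (Nat.not_dvd_of_pos_of_lt ha0 (by omega))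
    ⟨1, by omega⟩
  have hexpand (z : F) : (z - 1) ^ (Q - n * a) * (z ^ n - 1) ^ (2 * a) =
      ∑ u ∈ Finset.range (2 * a + 1), (-1 : F) ^ (2 * a - u) * (2 * a).choose u *
        ((z - 1) ^ (Q - n * a) * z ^ (n * u)) := by
    rw [sub_eq_add_neg (z ^ n), add_pow, Finset.mul_sum]
    exact Finset.sum_congr rfl fun u _ => by rw [pow_mul]; ring
  simp_rw [hexpand] at hsum
  rw [Finset.sum_comm, Finset.sum_eq_single a] at hsum
  · rw [← Finset.mul_sum, sum_sub_one_pow_mul_pow (by omega) (by omega)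
      (Or.inr (Nat.not_dvd_of_pos_of_lt hpos (by omega))), ← hQ, Nat.mod_eq_of_lt (by omega),
      Nat.sub_sub_self hle, Nat.choose_self] at hsum
    have h0 : ((2 * a).choose a : F) = 0 := by simpa using hsum
    rw [CharP.cast_eq_zero_iff F p] at h0
    have hdvd : p ∣ (2 * a).factorial := h0.trans
      ⟨a.factorial * (2 * a - a).factorial, by
        rw [← mul_assoc, Nat.choose_mul_factorial_mul_factorial (by omega)]⟩
    have := ((Fact.out : p.Prime).dvd_factorial).1 hdvd
    omega
  · intro u hu hua
    rw [Finset.mem_range] at hu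
    have hu2 : n * u ≤ n * (2 * a) := Nat.mul_le_mul_left n (by omega)
    have hn2a : n * (2 * a) = 2 * (n * a) := by ring
    have hndvd : u = 0 ∨ ¬ Q ∣ u := by
      rcases Nat.eq_zero_or_pos u with h | h
      · exact Or.inl h
      · exact Or.inr (Nat.not_dvd_of_pos_of_lt h (by omega))
    rw [← Finset.mul_sum, sum_sub_one_pow_mul_pow (by omega) (by omega)
      (hndvd.imp (by rintro rfl; rfl) fun h h' => h (hcop.symm.dvd_of_dvd_mul_left h')), ← hQ,
      Nat.sub_sub_self hle, Nat.choose_eq_zero_of_lt (n := n * u % Q)]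
    · simp
    · rcases Nat.lt_or_gt_of_ne hua with h | h
      · have : n * u < n * a := Nat.mul_lt_mul_of_pos_left h (by omega)
        rwa [Nat.mod_eq_of_lt (by omega)]
      · have : n * (a + 1) ≤ n * u := Nat.mul_le_mul_left n h
        rw [Nat.mod_eq_sub_mod (by omega), Nat.mod_eq_of_lt (by omega)]
        omega
  · intro h
    exact absurd (Finset.mem_range.2 (by omega)) h

theorem VanishingPowerSums.sum_sum_choose_eq_zero {p n n' j h : ℕ} [Fact p.Prime] [CharP F p]
    (hV : VanishingPowerSums F n) (hp : p = 2 * h + 1) (hn : n ≠ 0) (hn' : n' ≠ 0)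
    (hmod : n * p ^ j ≡ n' [MOD Fintype.card F - 1])
    (hc : h * (n + n') < Fintype.card F - 1)
    (huv : ∀ u < p, ∀ v < p, n * u + n' * v = 0 ∨ ¬ Fintype.card F - 1 ∣ n * u + n' * v) :
    ∑ u ∈ Finset.range p, ∑ v ∈ Finset.range p,
      (((n * u + n' * v) % (Fintype.card F - 1)).choose (h * (n + n')) : F) = 0 := by
  set Q := Fintype.card F - 1 with hQ
  have hh : 0 < h := by
    have := (Fact.out : p.Prime).one_lt
    omega
  have hpos : 0 < h * (n + n') := Nat.mul_pos hh (by omega)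
  have h1 : h * (n + n * p ^ j) ≡ h * (n + n') [MOD Q] := (hmod.add_left n).mul_left h
  have hndvd : ¬ Q ∣ h * (1 + p ^ j) := fun hd => Nat.not_dvd_of_pos_of_lt hpos hc <| by
    refine (h1.dvd_iff dvd_rfl).1 ?_
    rw [show h * (n + n * p ^ j) = n * (h * (1 + p ^ j)) by ring]
    exact hd.mul_left n
  have hsum := hV (h * (1 + p ^ j)) (Q - h * (n + n')) (by omega) hndvd (by
    have h2 := h1.add_left (Q - h * (n + n'))
    rw [Nat.sub_add_cancel hc.le] at h2
    have h3 := (h2.dvd_iff dvd_rfl).2 dvd_rfl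
    convert h3 using 1
    ring)
  have hexpand (z : F) : (z - 1) ^ (Q - h * (n + n')) * (z ^ n - 1) ^ (2 * (h * (1 + p ^ j))) =
      ∑ u ∈ Finset.range p, ∑ v ∈ Finset.range p,
        ((z - 1) ^ (Q - h * (n + n')) * z ^ (n * u + n' * v)) := by
    have h1 : 2 * (h * (1 + p ^ j)) = (p - 1) + p ^ j * (p - 1) := by
      rw [hp, Nat.add_sub_cancel]; ring
    have h2 : (z ^ n - 1) ^ p ^ j = z ^ n' - 1 := by
      rw [sub_pow_char_pow (p := p), one_pow, ← pow_mul,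
        pow_eq_pow_of_modEq_card_sub_one (mul_ne_zero hn (pow_ne_zero _ (by omega))) hn' hmod]
    rw [h1, pow_add, pow_mul, h2, sub_one_pow_char_sub_one p, sub_one_pow_char_sub_one p,
      Finset.sum_mul_sum, Finset.mul_sum]
    refine Finset.sum_congr rfl fun u _ => ?_
    rw [Finset.mul_sum]
    exact Finset.sum_congr rfl fun v _ => by rw [pow_add, pow_mul, pow_mul]
  simp_rw [hexpand] at hsum
  rw [Finset.sum_comm] at hsum
  rw [← neg_eq_zero, ← hsum, ← Finset.sum_neg_distrib]
  refine Finset.sum_congr rfl fun u hu => ?_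
  rw [Finset.sum_comm, ← Finset.sum_neg_distrib]
  refine Finset.sum_congr rfl fun v hv => ?_
  rw [sum_sub_one_pow_mul_pow (by omega) (by omega)
    (huv u (Finset.mem_range.1 hu) v (Finset.mem_range.1 hv)), ← hQ, Nat.sub_sub_self hc.le]

theorem VanishingPowerSums.mul_char_mod {p n : ℕ} [Fact p.Prime] [CharP F p]
    (hV : VanishingPowerSums F n) (hn : n ≠ 0) (hcop : p.Coprime (Fintype.card F - 1))
    (h0 : n * p % (Fintype.card F - 1) ≠ 0) :
    VanishingPowerSums F (n * p % (Fintype.card F - 1)) := by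
  intro t R hR ht hdvd
  set Q := Fintype.card F - 1 with hQ
  have hp : p ≠ 0 := (Fact.out : p.Prime).ne_zero
  rw [← hV (t * p) R hR (fun h => ht (hcop.symm.dvd_of_dvd_mul_right h)) ?_]
  · refine Finset.sum_congr rfl fun z _ => ?_
    rw [pow_eq_pow_of_modEq_card_sub_one h0 (mul_ne_zero hn hp) (Nat.mod_modEq _ _), pow_mul z n p,
      ← one_pow p, ← sub_pow_char (p := p), one_pow, ← pow_mul]
    congr 2
    ring
  · have h1 : R + n * p % Q * t ≡ R + n * p * t [MOD Q] :=
      ((Nat.mod_modEq _ _).mul_right t).add_left R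
    have := (h1.dvd_iff dvd_rfl).1 hdvd
    convert this using 2
    ring

end Permutation

section Digits

theorem digit_le_of_not_dvd_choose {p : ℕ} [Fact p.Prime] (i : ℕ) {a b : ℕ}
    (h : ¬ p ∣ a.choose b) : b / p ^ i % p ≤ a / p ^ i % p := by
  induction i generalizing a b with
  | zero =>
    by_contra! hlt
    refine h ((Choose.choose_modEq_choose_mod_mul_choose_div_nat.dvd_iff dvd_rfl).2 ?_)
    rw [Nat.choose_eq_zero_of_lt (by simpa using hlt), zero_mul]
    exact dvd_zero _
  | succ i ih =>
    rw [pow_succ', ← Nat.div_div_eq_div_mul, ← Nat.div_div_eq_div_mul]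
    refine ih fun h' => h ?_
    exact (Choose.choose_modEq_choose_mod_mul_choose_div_nat.dvd_iff dvd_rfl).2 (h'.mul_left _)

/-- If no carry can occur, the lowest digit is additive. -/
theorem mul_add_mul_div_and_mod {p x y u v : ℕ} (huv : u + v < p)
    (hx : x % p ≤ 1) (hy : y % p ≤ 1) :
    (x * u + y * v) / p = x / p * u + y / p * v ∧
      (x * u + y * v) % p = x % p * u + y % p * v := by
  have hlt : x % p * u + y % p * v < p := lt_of_le_of_lt (by nlinarith) huv
  have h : x * u + y * v = x % p * u + y % p * v + p * (x / p * u + y / p * v) := by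
    conv_lhs => rw [← Nat.mod_add_div x p, ← Nat.mod_add_div y p]
    ring
  constructor
  · rw [h, Nat.add_mul_div_left _ _ (by omega), Nat.div_eq_of_lt hlt, zero_add]
  · rw [h, Nat.add_mul_mod_self_left, Nat.mod_eq_of_lt hlt]

theorem mul_add_mul_div_pow {p n n' u v : ℕ} (huv : u + v < p)
    (hn : ∀ i, n / p ^ i % p ≤ 1) (hn' : ∀ i, n' / p ^ i % p ≤ 1) (i : ℕ) :
    (n * u + n' * v) / p ^ i = n / p ^ i * u + n' / p ^ i * v := by
  induction i with
  | zero => simp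
  | succ i ih =>
    simp only [pow_succ, ← Nat.div_div_eq_div_mul]
    rw [ih, (mul_add_mul_div_and_mod huv (hn i) (hn' i)).1]

theorem mul_add_mul_digit {p n n' u v : ℕ} (huv : u + v < p)
    (hn : ∀ i, n / p ^ i % p ≤ 1) (hn' : ∀ i, n' / p ^ i % p ≤ 1) (i : ℕ) :
    (n * u + n' * v) / p ^ i % p = n / p ^ i % p * u + n' / p ^ i % p * v := by
  rw [mul_add_mul_div_pow huv hn hn', (mul_add_mul_div_and_mod huv (hn i) (hn' i)).2]

theorem mul_lt_pow_of_digit_le_one {p n e u : ℕ} (hu : u < p)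
    (hn : ∀ i, n / p ^ i % p ≤ 1) (hlt : n < p ^ e) : n * u < p ^ e := by
  have := mul_add_mul_div_pow (v := 0) (n' := 0) (by simpa using hu) hn (by simp) e
  simp only [mul_zero, add_zero, Nat.div_eq_of_lt hlt, zero_mul] at this
  exact (Nat.div_eq_zero_iff_lt (pow_pos (by omega) e)).1 this

theorem mod_pow_div_pow_mod {p i m : ℕ} (hi : i < m) (x : ℕ) :
    x % p ^ m / p ^ i % p = x / p ^ i % p := by
  obtain ⟨d, rfl⟩ := Nat.exists_eq_add_of_lt hi
  rw [show p ^ (i + d + 1) = p ^ i * (p * p ^ d) by ring, Nat.mod_mul_right_div_self,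
    Nat.mod_mod_of_dvd _ (dvd_mul_right p _)]

theorem eq_of_digit_eq {p m x y : ℕ} (hx : x < p ^ m) (hy : y < p ^ m)
    (h : ∀ i < m, x / p ^ i % p = y / p ^ i % p) : x = y := by
  induction m generalizing x y with
  | zero => simp at hx hy; omega
  | succ m ih =>
    have h0 : x % p = y % p := by simpa using h 0 (by omega)
    have hdiv : x / p = y / p := by
      refine ih (Nat.div_lt_of_lt_mul (by rwa [← pow_succ']))
        (Nat.div_lt_of_lt_mul (by rwa [← pow_succ'])) fun i hi => ?_
      simpa only [Nat.div_div_eq_div_mul, ← pow_succ'] using h (i + 1) (by omega)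
    rw [← Nat.mod_add_div x p, ← Nat.mod_add_div y p, h0, hdiv]

/-- Multiplication by `p` modulo `p ^ (e + 1) - 1` rotates the digits in base `p`. -/
theorem mul_mod_pow_sub_one {p e x : ℕ} (hp : 1 < p) (hx : x < p ^ (e + 1) - 1) :
    x * p % (p ^ (e + 1) - 1) = p * (x % p ^ e) + x / p ^ e := by
  have hpe : 0 < p ^ e := by positivity
  have hd : x / p ^ e < p := Nat.div_lt_of_lt_mul (by rw [← pow_succ]; omega)
  have hl : x % p ^ e < p ^ e := Nat.mod_lt _ hpe
  have hxe := Nat.mod_add_div x (p ^ e)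
  rw [pow_succ] at hx ⊢
  generalize x / p ^ e = d at *
  generalize x % p ^ e = l at *
  generalize p ^ e = P at *
  obtain ⟨Q, hQ⟩ : ∃ Q, P * p = Q + 1 :=
    Nat.exists_eq_add_one.2 (Nat.mul_pos hpe (by omega))
  rw [hQ, Nat.add_sub_cancel] at hx ⊢
  have hlt : p * l + d < Q := by
    have h1 : p * (l + 1) ≤ p * P := Nat.mul_le_mul_left p hl
    rcases Nat.lt_or_ge (l + 1) P with h | h
    · have : p * (l + 1 + 1) ≤ p * P := Nat.mul_le_mul_left p h
      nlinarith
    · have hP : P = l + 1 := by omega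
      rcases Nat.lt_or_ge (d + 1) p with h' | h'
      · nlinarith
      · have : p = d + 1 := by omega
        subst this hP
        nlinarith
  rw [← hxe, show (l + P * d) * p = p * l + d + Q * d by linear_combination d * hQ,
    Nat.add_mul_mod_self_left, Nat.mod_eq_of_lt hlt]

theorem digit_zero_mul_mod {p e x : ℕ} (hp : 1 < p) (hx : x < p ^ (e + 1) - 1) :
    x * p % (p ^ (e + 1) - 1) % p = x / p ^ e % p := by
  rw [mul_mod_pow_sub_one hp hx, Nat.mul_add_mod]

theorem digit_succ_mul_mod {p e x i : ℕ} (hp : 1 < p) (hx : x < p ^ (e + 1) - 1) (hi : i < e) :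
    x * p % (p ^ (e + 1) - 1) / p ^ (i + 1) % p = x / p ^ i % p := by
  have hd : x / p ^ e < p := Nat.div_lt_of_lt_mul (by rw [← pow_succ]; omega)
  rw [mul_mod_pow_sub_one hp hx, pow_succ', ← Nat.div_div_eq_div_mul,
    Nat.mul_add_div (by omega), Nat.div_eq_of_lt hd, add_zero, mod_pow_div_pow_mod hi]

theorem sum_digit_mul_mod {p e x : ℕ} (hp : 1 < p) (hx : x < p ^ (e + 1) - 1) :
    ∑ i ∈ Finset.range (e + 1), x * p % (p ^ (e + 1) - 1) / p ^ i % p =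
      ∑ i ∈ Finset.range (e + 1), x / p ^ i % p := by
  rw [Finset.sum_range_succ', Finset.sum_range_succ, pow_zero, Nat.div_one,
    digit_zero_mul_mod hp hx]
  congr 1
  exact Finset.sum_congr rfl fun i hi => digit_succ_mul_mod hp hx (Finset.mem_range.1 hi)

/-- A number that is not a power of `p` and has digits at most `1` has two nonzero digits. -/
theorem exists_two_digits {p n : ℕ} (hp : 1 < p) (hn0 : n ≠ 0)
    (hn : ∀ i, n / p ^ i % p ≤ 1) (hpow : ∀ b, n ≠ p ^ b) :
    ∃ a b, a < b ∧ p ^ b ≤ n ∧ n / p ^ a % p = 1 ∧ n / p ^ b % p = 1 := by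
  have top {m : ℕ} (hm : m ≠ 0) : 0 < m / p ^ Nat.log p m ∧ m / p ^ Nat.log p m < p :=
    ⟨Nat.div_pos (Nat.pow_log_le_self p hm) (by positivity),
      Nat.div_lt_of_lt_mul (by rw [← pow_succ]; exact Nat.lt_pow_succ_log_self hp m)⟩
  obtain ⟨hb0, hbp⟩ := top hn0
  have hble := Nat.pow_log_le_self p hn0
  generalize Nat.log p n = b at hb0 hbp hble
  have hb1 : n / p ^ b = 1 := by
    have := hn b
    rw [Nat.mod_eq_of_lt hbp] at this
    omega
  have hr : n % p ^ b ≠ 0 := fun h => hpow b <| by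
    rw [← Nat.mod_add_div n (p ^ b), h, hb1]; simp
  obtain ⟨ha0, hap⟩ := top hr
  have hab : Nat.log p (n % p ^ b) < b :=
    Nat.log_lt_of_lt_pow hr (Nat.mod_lt _ (by positivity))
  generalize Nat.log p (n % p ^ b) = a at ha0 hap hab
  have hdig := mod_pow_div_pow_mod (p := p) hab n
  rw [Nat.mod_eq_of_lt hap] at hdig
  have := hn a
  exact ⟨a, b, hab, hble, by omega, by rw [hb1, Nat.mod_eq_of_lt hp]⟩

/-- Multiplying by `p` repeatedly modulo `p ^ (e + 1) - 1` shifts the lower digits upwards. -/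
theorem digit_add_mul_pow_mod {p e x i m : ℕ} (hp : 1 < p) (hx : x < p ^ (e + 1) - 1)
    (him : i + m ≤ e) :
    x * p ^ m % (p ^ (e + 1) - 1) / p ^ (i + m) % p = x / p ^ i % p := by
  induction m with
  | zero => rw [pow_zero, mul_one, Nat.mod_eq_of_lt hx, add_zero]
  | succ m ih =>
    rw [← ih (by omega), pow_succ, ← mul_assoc, ← Nat.mod_mul_mod, ← add_assoc]
    exact digit_succ_mul_mod hp (Nat.mod_lt _ (by omega)) (by omega)

theorem sum_digit_mul_pow_mod {p e x : ℕ} (hp : 1 < p) (hx : x < p ^ (e + 1) - 1) (m : ℕ) :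
    ∑ i ∈ Finset.range (e + 1), x * p ^ m % (p ^ (e + 1) - 1) / p ^ i % p =
      ∑ i ∈ Finset.range (e + 1), x / p ^ i % p := by
  induction m with
  | zero => rw [pow_zero, mul_one, Nat.mod_eq_of_lt hx]
  | succ m ih =>
    rw [← ih, pow_succ, ← mul_assoc, ← Nat.mod_mul_mod]
    exact sum_digit_mul_mod hp (Nat.mod_lt _ (by omega))

/-- Distinct numbers with the same digit sum have a digit where the first is smaller. -/
theorem exists_digit_lt {p m x y : ℕ} (hx : x < p ^ m) (hy : y < p ^ m) (hxy : x ≠ y)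
    (hsum : ∑ i ∈ Finset.range m, x / p ^ i % p = ∑ i ∈ Finset.range m, y / p ^ i % p) :
    ∃ i, x / p ^ i % p < y / p ^ i % p := by
  by_contra! hle
  refine hxy (eq_of_digit_eq hx hy fun i hi => ?_)
  exact ((Finset.sum_eq_sum_iff_of_le fun i _ => hle i).1 hsum.symm i (Finset.mem_range.2 hi)).symm

theorem coprime_mul_pow_mod {p Q n : ℕ} (hcop : n.Coprime Q) (hp : p.Coprime Q) (m : ℕ) :
    (n * p ^ m % Q).Coprime Q :=
  (Nat.mod_modEq _ _).gcd_eq.trans (hcop.mul_left (hp.pow_left m))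

end Digits

section Rotations

variable {F : Type*} [Field F] [Fintype F] {p e : ℕ} [Fact p.Prime] [CharP F p]

theorem VanishingPowerSums.false_of_two_rotations {n n' j h : ℕ}
    (hV : VanishingPowerSums F n) (hp : p = 2 * h + 1) (hcard : Fintype.card F = p ^ (e + 1))
    (hcop : n.Coprime (Fintype.card F - 1)) (hcop' : n'.Coprime (Fintype.card F - 1))
    (hmod : n * p ^ j ≡ n' [MOD Fintype.card F - 1])
    (hn1 : n ≠ 1) (hn1' : n' ≠ 1) (hn : n < Fintype.card F) (hn' : n' < Fintype.card F)
    (htop : p ^ e ≤ n) (htop' : p ^ e ≤ n')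
    (hdig : ∀ i, n / p ^ i % p ≤ 1) (hdig' : ∀ i, n' / p ^ i % p ≤ 1)
    (hlt : ∃ i, n / p ^ i % p < n' / p ^ i % p) (hgt : ∃ i, n' / p ^ i % p < n / p ^ i % p) :
    False := by
  have hpe : 0 < p ^ e := by have := (Fact.out : p.Prime).pos; positivity
  have small {x : ℕ} (hcop : x.Coprime (Fintype.card F - 1)) (hx1 : x ≠ 1)
      (hx : x < Fintype.card F) (hdig : ∀ i, x / p ^ i % p ≤ 1) :
      x * (2 * h) < Fintype.card F - 1 := by
    have h1 : x * (2 * h) < Fintype.card F := by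
      rw [hcard] at hx ⊢
      exact mul_lt_pow_of_digit_le_one (by omega) hdig hx
    have h2 : x * (2 * h) ≠ Fintype.card F - 1 := fun h =>
      hx1 (Nat.eq_one_of_dvd_coprimes hcop dvd_rfl ⟨_, h.symm⟩)
    omega
  have hs := small hcop hn1 hn hdig
  have hs' := small hcop' hn1' hn' hdig'
  set Q := Fintype.card F - 1 with hQ
  have hc2 : 2 * (h * (n + n')) = n * (2 * h) + n' * (2 * h) := by ring
  have hlow {u v : ℕ} (huv : u + v < p) : n * u + n' * v < Q := by
    rcases le_total n n' with hle | hle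
    · have : n * u + n' * v ≤ n' * (u + v) := by nlinarith
      have : n' * (u + v) ≤ n' * (2 * h) := Nat.mul_le_mul_left _ (by omega)
      omega
    · have : n * u + n' * v ≤ n * (u + v) := by nlinarith
      have : n * (u + v) ≤ n * (2 * h) := Nat.mul_le_mul_left _ (by omega)
      omega
  have hhigh {u v : ℕ} (huv : p ≤ u + v) : Q < n * u + n' * v := by
    have h1 : p ^ e * (u + v) ≤ n * u + n' * v := by nlinarith
    have h2 : p ^ e * p ≤ p ^ e * (u + v) := Nat.mul_le_mul_left _ huv
    rw [← pow_succ, ← hcard] at h2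
    have := Fintype.card_pos (α := F)
    omega
  have hup {u v : ℕ} (hu : u < p) (hv : v < p) : n * u + n' * v ≤ 2 * (h * (n + n')) := by
    rw [hc2]
    exact Nat.add_le_add (Nat.mul_le_mul_left _ (by omega)) (Nat.mul_le_mul_left _ (by omega))
  have hsum := hV.sum_sum_choose_eq_zero (n' := n') (j := j) hp (by omega) (by omega) hmod
    (by omega) (fun u hu v hv => by
      rcases Nat.lt_or_ge (u + v) p with huv | huv
      · have := hlow huv
        rcases Nat.eq_zero_or_pos (n * u + n' * v) with h0 | h0
        · exact Or.inl h0
        · exact Or.inr (Nat.not_dvd_of_pos_of_lt h0 this)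
      · have h1 := hhigh huv
        have h2 := hup hu hv
        refine Or.inr fun hd => ?_
        have h3 : Q ∣ n * u + n' * v - Q := Nat.dvd_sub hd dvd_rfl
        exact Nat.not_dvd_of_pos_of_lt (by omega) (by omega) h3)
  have hzero {u v : ℕ} (hu : u < p) (hv : v < p) (hne : ¬ (u = h ∧ v = h)) :
      (((n * u + n' * v) % Q).choose (h * (n + n')) : F) = 0 := by
    rcases Nat.lt_or_ge (u + v) p with huv | huv
    · rw [Nat.mod_eq_of_lt (hlow huv), CharP.cast_eq_zero_iff F p]
      by_contra hnd
      have key (i : ℕ) := digit_le_of_not_dvd_choose i hnd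
      simp only [show h * (n + n') = n * h + n' * h by ring, mul_add_mul_digit huv hdig hdig',
        mul_add_mul_digit (show h + h < p by omega) hdig hdig'] at key
      obtain ⟨i, hi⟩ := hlt
      obtain ⟨i', hi'⟩ := hgt
      have k1 := key i
      have k2 := key i'
      have d1 := hdig' i
      have d2 := hdig i'
      rw [show n / p ^ i % p = 0 by omega, show n' / p ^ i % p = 1 by omega] at k1
      rw [show n' / p ^ i' % p = 0 by omega, show n / p ^ i' % p = 1 by omega] at k2
      omega
    · have h1 := hhigh huv
      have h2 := hup hu hv
      rw [Nat.mod_eq_sub_mod h1.le, Nat.mod_eq_of_lt (by omega),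
        Nat.choose_eq_zero_of_lt (by omega), Nat.cast_zero]
  rw [Finset.sum_eq_single h, Finset.sum_eq_single h] at hsum
  · rw [Nat.mod_eq_of_lt (hlow (by omega)), show n * h + n' * h = h * (n + n') by ring,
      Nat.choose_self, Nat.cast_one] at hsum
    exact one_ne_zero hsum
  · exact fun v hv hvh => hzero (by omega) (Finset.mem_range.1 hv) fun h => hvh h.2
  · exact fun hh => absurd (Finset.mem_range.2 (by omega)) hh
  · exact fun u hu huh => Finset.sum_eq_zero fun v hv =>
      hzero (Finset.mem_range.1 hu) (Finset.mem_range.1 hv) fun h => huh h.1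
  · exact fun hh => absurd (Finset.mem_range.2 (by omega)) hh

theorem VanishingPowerSums.div_pow_le_one {n : ℕ} (hV : VanishingPowerSums F n)
    (hcard : Fintype.card F = p ^ (e + 1)) (hodd : Odd p)
    (hcop : n.Coprime (Fintype.card F - 1)) (hn0 : n ≠ 0) (hn : n < Fintype.card F - 1) :
    n / p ^ e ≤ 1 := by
  have hpe : 0 < p ^ e := by have := (Fact.out : p.Prime).pos; positivity
  rcases eq_or_ne n 1 with rfl | hn1
  · exact Nat.div_le_self _ _
  have heven : Even (Fintype.card F - 1) := by
    rw [hcard]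
    exact Nat.Odd.sub_odd hodd.pow odd_one
  have h1 := hV.le_two_mul_div hcop heven (by omega) hn
  have h2 := Nat.div_mul_le_self (Fintype.card F - 1) n
  rw [← Nat.lt_succ_iff, Nat.div_lt_iff_lt_mul hpe]
  by_contra! h3
  have h4 : p * n ≤ 2 * ((Fintype.card F - 1) / n) * n := Nat.mul_le_mul_right n h1
  have h5 : p * (Nat.succ 1 * p ^ e) ≤ p * n := Nat.mul_le_mul_left p h3
  have h6 : p * (Nat.succ 1 * p ^ e) = 2 * Fintype.card F := by rw [hcard, pow_succ]; ring
  have := Fintype.card_pos (α := F)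
  rw [mul_assoc] at h4
  omega

theorem VanishingPowerSums.mul_pow_mod {n : ℕ} (hV : VanishingPowerSums F n)
    (hQ : 1 < Fintype.card F - 1) (hp : p.Coprime (Fintype.card F - 1))
    (hcop : n.Coprime (Fintype.card F - 1)) (hn : n < Fintype.card F - 1) (m : ℕ) :
    VanishingPowerSums F (n * p ^ m % (Fintype.card F - 1)) := by
  have hne (m : ℕ) : n * p ^ m % (Fintype.card F - 1) ≠ 0 := fun h => by
    have := coprime_mul_pow_mod hcop hp m
    rw [h, Nat.coprime_zero_left] at this
    omega
  induction m with
  | zero => rwa [pow_zero, mul_one, Nat.mod_eq_of_lt hn]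
  | succ m ih =>
    have h0 := hne (m + 1)
    rw [pow_succ, ← mul_assoc, ← Nat.mod_mul_mod] at h0 ⊢
    exact ih.mul_char_mod (hne m) hp h0

theorem VanishingPowerSums.digit_le_one {n : ℕ} (hV : VanishingPowerSums F n)
    (hcard : Fintype.card F = p ^ (e + 1)) (hodd : Odd p) (hQ : 1 < Fintype.card F - 1)
    (hp : p.Coprime (Fintype.card F - 1)) (hcop : n.Coprime (Fintype.card F - 1))
    (hn : n < Fintype.card F - 1) (i : ℕ) : n / p ^ i % p ≤ 1 := by
  have hp1 : 1 < p := (Fact.out : p.Prime).one_lt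
  rcases Nat.lt_or_ge e i with hi | hi
  · have : p ^ (e + 1) ≤ p ^ i := Nat.pow_le_pow_right (by omega) hi
    rw [Nat.div_eq_of_lt (by omega), Nat.zero_mod]
    exact zero_le_one
  · have hcop' := coprime_mul_pow_mod hcop hp (e - i)
    have h1 := (hV.mul_pow_mod hQ hp hcop hn (e - i)).div_pow_le_one hcard hodd hcop'
      (fun h => by rw [h, Nat.coprime_zero_left] at hcop'; omega) (Nat.mod_lt _ (by omega))
    rw [hcard] at hn h1
    rw [← digit_add_mul_pow_mod hp1 hn (show i + (e - i) ≤ e by omega), Nat.add_sub_cancel' hi]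
    exact (Nat.mod_le _ _).trans h1

theorem VanishingPowerSums.exists_eq_pow {n : ℕ} (hV : VanishingPowerSums F n)
    (hcard : Fintype.card F = p ^ (e + 1)) (hodd : Odd p) (hQ : 1 < Fintype.card F - 1)
    (hcop : n.Coprime (Fintype.card F - 1)) (hn : n < Fintype.card F - 1) :
    ∃ b, n = p ^ b := by
  have hp1 : 1 < p := (Fact.out : p.Prime).one_lt
  have hp : p.Coprime (Fintype.card F - 1) := by
    rw [hcard]
    refine ((Nat.coprime_self_sub_right (Nat.one_le_pow _ _ (by omega))).2
      (Nat.coprime_one_right _)).coprime_dvd_left (dvd_pow_self p e.succ_ne_zero)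
  have hn0 : n ≠ 0 := fun h => by
    rw [h, Nat.coprime_zero_left] at hcop
    omega
  by_contra! hpow
  obtain ⟨a, b, hab, hbn, ha, hb⟩ := exists_two_digits hp1 hn0
    (hV.digit_le_one hcard hodd hQ hp hcop hn) hpow
  have hbe : b ≤ e := by
    have : p ^ b < p ^ (e + 1) := by omega
    have := (Nat.pow_lt_pow_iff_right hp1).1 this
    omega
  have hV' (m : ℕ) := hV.mul_pow_mod hQ hp hcop hn m
  have hcop' (m : ℕ) := coprime_mul_pow_mod hcop hp m
  have hlt (m : ℕ) : n * p ^ m % (Fintype.card F - 1) < Fintype.card F - 1 :=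
    Nat.mod_lt _ (by omega)
  have hdig (m : ℕ) := (hV' m).digit_le_one hcard hodd hQ hp (hcop' m) (hlt m)
  have htop {i : ℕ} (hi : i ≤ e) (h : n / p ^ i % p = 1) :
      p ^ e ≤ n * p ^ (e - i) % (Fintype.card F - 1) := by
    by_contra! hl
    have := digit_add_mul_pow_mod hp1 (hcard ▸ hn) (show i + (e - i) ≤ e by omega)
    rw [Nat.add_sub_cancel' hi, ← hcard, Nat.div_eq_of_lt hl, h, Nat.zero_mod] at this
    omega
  have hpe : 1 < p ^ e := Nat.one_lt_pow (by omega) hp1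
  have htopa := htop (by omega) ha
  have htopb := htop hbe hb
  have hmod : n * p ^ (e - b) % (Fintype.card F - 1) * p ^ (b - a) ≡
      n * p ^ (e - a) % (Fintype.card F - 1) [MOD Fintype.card F - 1] := by
    refine ((Nat.mod_modEq _ _).mul_right _).trans ?_
    rw [mul_assoc, ← pow_add, show e - b + (b - a) = e - a by omega]
    exact (Nat.mod_modEq _ _).symm
  have hne : n * p ^ (e - b) % (Fintype.card F - 1) ≠ n * p ^ (e - a) % (Fintype.card F - 1) := by
    intro h
    rw [← h] at hmod
    have h1 : p ^ (b - a) ≡ 1 [MOD Fintype.card F - 1] :=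
      Nat.ModEq.cancel_left_of_coprime (hcop' (e - b)).symm (by rwa [mul_one])
    have h2 : 1 < p ^ (b - a) := Nat.one_lt_pow (by omega) hp1
    have h3 : p ^ (b - a) ≤ p ^ e := Nat.pow_le_pow_right (by omega) (by omega)
    exact h2.ne' (h1.eq_of_lt_of_lt (by have := hlt (e - b); omega) hQ)
  have hltc (m : ℕ) : n * p ^ m % (Fintype.card F - 1) < p ^ (e + 1) := by
    have := hlt m
    omega
  have hsum (m : ℕ) := sum_digit_mul_pow_mod hp1 (hcard ▸ hn) m
  rw [← hcard] at hsum
  obtain ⟨h, hh⟩ := hodd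
  exact (hV' (e - b)).false_of_two_rotations hh hcard (hcop' _) (hcop' _) hmod (by omega)
    (by omega) (by have := hlt (e - b); omega) (by have := hlt (e - a); omega) htopb htopa
    (hdig _) (hdig _)
    (exists_digit_lt (hltc _) (hltc _) hne ((hsum _).trans (hsum _).symm))
    (exists_digit_lt (hltc _) (hltc _) hne.symm ((hsum _).trans (hsum _).symm))

end Rotations

end MonomialDifference

open MonomialDifference in
theorem stmt_7 (p e k : ℕ) (hp : p.Prime) (hodd : Odd p) (he : 1 ≤ e)
    (hk1 : 1 ≤ k) (hk2 : k ≤ p ^ e - 1)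
    (F : Type*) [Field F] [Fintype F] (hF : Fintype.card F = p ^ e)
    (hPP : Function.Bijective (fun x : F => x ^ k * ((x + 1) ^ k - x ^ k))) :
    ∃ j : ℕ, k = p ^ j := by
  obtain ⟨e, rfl⟩ := Nat.exists_eq_add_of_le' he
  have : Fact p.Prime := ⟨hp⟩
  have : CharP F p := charP_of_card_eq_prime_pow hF
  have hp3 : 3 ≤ p := by
    have := hp.two_le
    obtain ⟨h, rfl⟩ := hodd
    omega
  have hpe : 1 ≤ p ^ e := Nat.one_le_pow _ _ (by omega)
  have hQ : 1 < Fintype.card F - 1 := by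
    have : 3 * 1 ≤ p * p ^ e := Nat.mul_le_mul hp3 hpe
    rw [hF, pow_succ']
    omega
  have hkcop := coprime_of_injective (by omega) hPP.injective (by omega)
  obtain ⟨n, hnlt, hkn⟩ := Nat.exists_mul_mod_eq_one_of_coprime hkcop hQ
  have hkn' : n * k ≡ 1 [MOD Fintype.card F - 1] := by
    rw [mul_comm, Nat.ModEq, hkn, Nat.mod_eq_of_lt hQ]
  have hncop : n.Coprime (Fintype.card F - 1) :=
    Nat.Coprime.coprime_mul_right (k := k) (hkn'.gcd_eq.trans (Nat.gcd_one_left _))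
  have hn0 : n ≠ 0 := fun h => by
    rw [h, Nat.coprime_zero_left] at hncop
    omega
  obtain ⟨b, rfl⟩ := (vanishingPowerSums_of_bijective (by omega) hn0 hkn' hPP).exists_eq_pow
    hF hodd hQ hncop hnlt
  have hb : b < e + 1 := (Nat.pow_lt_pow_iff_right hp.one_lt).1 (by omega)
  have key {j : ℕ} (hj : p ^ b * p ^ j ≡ 1 [MOD Fintype.card F - 1])
      (hlt : p ^ j ≤ Fintype.card F - 1) : k = p ^ j := by
    have h1 : k ≡ p ^ j [MOD Fintype.card F - 1] :=
      Nat.ModEq.cancel_left_of_coprime hncop.symm (hkn'.trans hj.symm)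
    have h2 : 0 < p ^ j := pow_pos hp.pos j
    refine h1.eq_of_abs_lt (abs_lt.2 ⟨?_, ?_⟩) <;> omega
  rcases Nat.eq_zero_or_pos b with rfl | hb0
  · exact ⟨0, key (by simp [Nat.ModEq]) (by simpa using hQ.le)⟩
  · refine ⟨e + 1 - b, key ?_ ?_⟩
    · rw [← pow_add, Nat.add_sub_cancel' hb.le, ← hF]
      exact ((Nat.modEq_iff_dvd' (by omega)).2 dvd_rfl).symm
    · have : p ^ (e + 1 - b) < p ^ (e + 1) := Nat.pow_lt_pow_right hp.one_lt (by omega)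
      omega
end

section
/- Let p be an odd prime, q = p^e, and 1 ≤ k ≤ q - 1. The polynomial A_k(X) = X^k·((X+1)^k − X^k) is a permutation polynomial of F_q if and only if k is a power of p; moreover, this holds if and only if the map x ↦ x^k·((x+1)^k − x^k) is injective on F_q. -/
open Finset

/-- The map `x ↦ x ^ k * ((x + 1) ^ k - x ^ k)` attached to the polynomial `A_k`. -/
def monomialGraphMap (F : Type*) [Field F] (k : ℕ) (x : F) : F :=
  x ^ k * ((x + 1) ^ k - x ^ k)

/-- `l` is inverse modulo `|F| - 1` to some `k` for which `A_k` permutes `F`. -/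
def IsInversePermExponent (F : Type*) [Field F] [Fintype F] (l : ℕ) : Prop :=
  ∃ k, 1 ≤ k ∧ Function.Bijective (monomialGraphMap F k) ∧ l * k ≡ 1 [MOD Fintype.card F - 1]

section PowerSums

variable {F : Type*} [Field F] [Fintype F]

lemma pow_eq_pow_of_modEq_card_sub_one {x : F} (hx : x ≠ 0) {a b : ℕ}
    (h : a ≡ b [MOD Fintype.card F - 1]) : x ^ a = x ^ b := by
  rw [pow_eq_pow_mod a (FiniteField.pow_card_sub_one_eq_one x hx),
    pow_eq_pow_mod b (FiniteField.pow_card_sub_one_eq_one x hx), h]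

lemma pow_eq_pow_of_modEq_card_sub_one' (x : F) {a b : ℕ}
    (h : a ≡ b [MOD Fintype.card F - 1]) (h0 : a = 0 ↔ b = 0) : x ^ a = x ^ b := by
  by_cases hx : x = 0
  · subst hx
    by_cases ha : a = 0
    · rw [ha, h0.1 ha]
    · rw [zero_pow ha, zero_pow (mt h0.2 ha)]
  · exact pow_eq_pow_of_modEq_card_sub_one hx h

lemma sum_pow_card_sub_one : ∑ x : F, x ^ (Fintype.card F - 1) = -1 := by
  classical
  have h1 : 0 < Fintype.card F - 1 := by have := Fintype.one_lt_card (α := F); omega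
  have h : ∀ x : F, x ^ (Fintype.card F - 1) = 1 - if x = 0 then 1 else 0 := by
    intro x
    split_ifs with hx
    · rw [hx, zero_pow h1.ne', sub_self]
    · rw [FiniteField.pow_card_sub_one_eq_one x hx, sub_zero]
  simp [h]

lemma sum_pow_of_lt_two_mul {i : ℕ} (hi : i < 2 * (Fintype.card F - 1)) :
    ∑ x : F, x ^ i = if i = Fintype.card F - 1 then -1 else 0 := by
  have h1 : 0 < Fintype.card F - 1 := by have := Fintype.one_lt_card (α := F); omega
  split_ifs with h
  · rw [h, sum_pow_card_sub_one]
  rcases lt_or_gt_of_ne h with h | h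
  · exact FiniteField.sum_pow_lt_card_sub_one F i h
  · rw [← FiniteField.sum_pow_lt_card_sub_one F (i - (Fintype.card F - 1)) (by omega)]
    refine sum_congr rfl fun x _ => pow_eq_pow_of_modEq_card_sub_one' x ?_ (by omega)
    conv_lhs => rw [← Nat.sub_add_cancel h.le]
    simp [Nat.ModEq]

/-- The power sum reading off a binomial coefficient. -/
lemma sum_pow_mul_add_one_pow {n r : ℕ} (hn : 0 < n) (hnQ : n < Fintype.card F - 1)
    (hr : r ≤ Fintype.card F - 1) :
    ∑ w : F, w ^ (Fintype.card F - 1 - n) * (w + 1) ^ r = -(r.choose n : F) := by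
  have h : ∀ w : F, w ^ (Fintype.card F - 1 - n) * (w + 1) ^ r =
      ∑ j ∈ range (r + 1), (r.choose j : F) * w ^ (Fintype.card F - 1 - n + j) := by
    intro w
    rw [add_pow, mul_sum]
    refine sum_congr rfl fun j _ => ?_
    rw [pow_add]; ring
  simp_rw [h]
  rw [sum_comm]
  simp_rw [← mul_sum]
  have h2 : ∀ j ∈ range (r + 1),
      (r.choose j : F) * ∑ w : F, w ^ (Fintype.card F - 1 - n + j) =
        if j = n then -(r.choose n : F) else 0 := by
    intro j hj
    rw [mem_range] at hj
    rw [sum_pow_of_lt_two_mul (by omega)]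
    by_cases hjn : j = n
    · subst hjn
      rw [if_pos (by omega), if_pos rfl]; ring
    · rw [if_neg (by omega), if_neg hjn, mul_zero]
  rw [sum_congr rfl h2, sum_ite_eq' (range (r + 1)) n]
  split_ifs with hmem
  · rfl
  · rw [mem_range] at hmem
    rw [Nat.choose_eq_zero_of_lt (by omega)]; simp

lemma sum_pow_mul_add_one_pow_of_modEq {n r N : ℕ} (hn : 0 < n) (hnQ : n < Fintype.card F - 1)
    (hr : r ≤ Fintype.card F - 1) (h : N ≡ r [MOD Fintype.card F - 1]) (h0 : N = 0 ↔ r = 0) :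
    ∑ w : F, w ^ (Fintype.card F - 1 - n) * (w + 1) ^ N = -(r.choose n : F) := by
  rw [← sum_pow_mul_add_one_pow hn hnQ hr]
  refine sum_congr rfl fun w _ => ?_
  rw [pow_eq_pow_of_modEq_card_sub_one' _ h h0]

/-- Hermite-type criterion: the vanishing power sums of the permutation `A_k`, after the
substitution `x = 1 / ((w + 1) ^ l - 1)`. -/
lemma IsInversePermExponent.sum_eq_zero {l : ℕ} (hl : IsInversePermExponent F l) {s n : ℕ}
    (hn : 0 < n) (hnQ : n < Fintype.card F - 1) (hs : l * s ≡ n [MOD Fintype.card F - 1]) :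
    ∑ w : F, w ^ (Fintype.card F - 1 - n) * ((w + 1) ^ l - 1) ^ (2 * s) = 0 := by
  obtain ⟨k, hk, hbij, hlk⟩ := hl
  set Q := Fintype.card F - 1 with hQ
  have hl0 : l ≠ 0 := by
    rintro rfl
    rw [zero_mul] at hlk
    have := (Nat.modEq_iff_dvd' (Nat.zero_le 1)).1 hlk
    have := Nat.le_of_dvd one_pos this
    omega
  have hpow : ∀ z : F, (z ^ l) ^ k = z := by
    intro z
    rw [← pow_mul]
    conv_rhs => rw [← pow_one z]
    exact pow_eq_pow_of_modEq_card_sub_one' z hlk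
      (by simp only [mul_eq_zero, one_ne_zero, iff_false]; omega)
  have hinj : Function.Injective fun w : F => ((w + 1) ^ l - 1)⁻¹ := by
    intro a b hab
    have h1 : (a + 1) ^ l = (b + 1) ^ l := by simpa using hab
    have h2 := congrArg (· ^ k) h1
    simp only [hpow] at h2
    exact add_right_cancel h2
  have hbij' : Function.Bijective fun w : F => ((w + 1) ^ l - 1)⁻¹ :=
    Finite.injective_iff_bijective.1 hinj
  have hkm : 2 * s + 2 * k * (Q - n) ≡ 0 [MOD Q] := by
    have e1 : s ≡ k * n [MOD Q] := by
      calc s = 1 * s := (one_mul s).symm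
        _ ≡ l * k * s [MOD Q] := hlk.symm.mul_right s
        _ = k * (l * s) := by ring
        _ ≡ k * n [MOD Q] := hs.mul_left k
    calc 2 * s + 2 * k * (Q - n) ≡ 2 * (k * n) + 2 * k * (Q - n) [MOD Q] :=
          (e1.mul_left 2).add_right _
      _ = 2 * k * (n + (Q - n)) := by ring
      _ = 2 * k * Q := by rw [Nat.add_sub_cancel' hnQ.le]
      _ ≡ 0 [MOD Q] := by simp [Nat.ModEq]
  have hterm : ∀ w : F, w ^ (Q - n) * ((w + 1) ^ l - 1) ^ (2 * s) =
      monomialGraphMap F k (((w + 1) ^ l - 1)⁻¹) ^ (Q - n) := by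
    intro w
    by_cases hw : w = 0
    · subst hw
      simp [monomialGraphMap, zero_pow (show k ≠ 0 by omega), show Q - n ≠ 0 by omega]
    have hu : (w + 1) ^ l - 1 ≠ 0 := by
      intro h
      apply hw
      apply hinj
      simp [h]
    have hw' : ((w + 1) ^ l - 1 + 1) ^ k = w + 1 := by rw [sub_add_cancel, hpow]
    generalize (w + 1) ^ l - 1 = u at hu hw'
    have hA : monomialGraphMap F k u⁻¹ = w * u⁻¹ ^ (2 * k) := by
      have h3 : u⁻¹ + 1 = u⁻¹ * (u + 1) := by field_simp; ring
      rw [monomialGraphMap, h3, mul_pow, hw']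
      ring
    rw [hA, mul_pow, ← pow_mul]
    congr 1
    rw [inv_pow]
    apply eq_inv_of_mul_eq_one_left
    rw [← pow_add]
    simpa using pow_eq_pow_of_modEq_card_sub_one hu hkm
  rw [sum_congr rfl fun w _ => hterm w]
  rw [hbij'.sum_comp fun x => monomialGraphMap F k x ^ (Q - n)]
  rw [hbij.sum_comp fun x => x ^ (Q - n)]
  exact FiniteField.sum_pow_lt_card_sub_one F _ (by omega)

end PowerSums

section Digits

lemma sum_digits_succ (p e : ℕ) (f : ℕ → ℕ) :
    ∑ j ∈ range (e + 1), f j * p ^ j = f 0 + p * ∑ j ∈ range e, f (j + 1) * p ^ j := by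
  rw [sum_range_succ', mul_sum, add_comm]
  congr 1
  · simp
  · exact sum_congr rfl fun j _ => by ring

/-- A digitwise consequence of the Lucas theorem. -/
lemma dvd_choose_of_digit_lt {p : ℕ} (hp : p.Prime) (e : ℕ) (f g : ℕ → ℕ)
    (hf : ∀ j, f j < p) (hg : ∀ j, g j < p) {i : ℕ} (hi : i < e) (hlt : f i < g i) :
    p ∣ (∑ j ∈ range e, f j * p ^ j).choose (∑ j ∈ range e, g j * p ^ j) := by
  have := Fact.mk hp
  induction e generalizing f g i with
  | zero => omega
  | succ e ih =>
    rw [sum_digits_succ, sum_digits_succ]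
    refine (Nat.modEq_zero_iff_dvd).1
      (Choose.choose_modEq_choose_mod_mul_choose_div_nat.trans ((Nat.modEq_zero_iff_dvd).2 ?_))
    rw [Nat.add_mul_mod_self_left, Nat.add_mul_mod_self_left, Nat.mod_eq_of_lt (hf 0),
      Nat.mod_eq_of_lt (hg 0), Nat.add_mul_div_left _ _ hp.pos, Nat.add_mul_div_left _ _ hp.pos,
      Nat.div_eq_of_lt (hf 0), Nat.div_eq_of_lt (hg 0), zero_add, zero_add]
    cases i with
    | zero => rw [Nat.choose_eq_zero_of_lt hlt]; simp
    | succ i =>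
      exact Dvd.dvd.mul_left
        (ih (fun j => f (j + 1)) (fun j => g (j + 1)) (fun j => hf _) (fun j => hg _)
          (i := i) (by omega) hlt) _

/-- The residues reached by the exponents in the expansion of `(y - 1) ^ ((p - 1) * (1 + p ^ b))`:
only the middle one has a binomial coefficient prime to `p`. -/
lemma exists_residue_dvd_choose {p h Q L M L' M' : ℕ} (hph : p = 2 * h + 1) (hh : 1 ≤ h)
    (hL : p * L = L' + Q) (hM : p * M = M' + Q)
    (hL0' : 0 < L') (hM0' : 0 < M')
    (hLQ : (p - 1) * L < Q) (hMQ : (p - 1) * M < Q)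
    (hLQ' : (p - 1) * L' < Q) (hMQ' : (p - 1) * M' < Q)
    (hdvd : ∀ i j, i + j = 2 * h → i ≠ h → p ∣ (i * L + j * M).choose (h * (L + M)))
    {i j : ℕ} (hi : i < p) (hj : j < p) (hij : ¬ (i = h ∧ j = h)) :
    ∃ r ≤ Q, i * L + j * M ≡ r [MOD Q] ∧ (i * L + j * M = 0 ↔ r = 0) ∧
      p ∣ r.choose (h * (L + M)) := by
  subst hph
  simp only [Nat.add_sub_cancel] at *
  rcases lt_trichotomy (i + j) (2 * h) with hlt | heq | hgt
  · have hr : i * L + j * M < h * (L + M) := by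
      obtain ⟨c, hc⟩ : ∃ c, 2 * h = i + j + 1 + c := ⟨2 * h - (i + j + 1), by omega⟩
      have h1 : i * L' ≤ i * (L' + M') := by gcongr; omega
      have key : (2 * h) * (i * L' + j * M') ≤ (i + j) * Q := by nlinarith
      have key2 : i * L' + j * M' ≤ Q := by
        have : (2 * h) * (i * L' + j * M') ≤ (2 * h) * Q := key.trans (by gcongr)
        exact Nat.le_of_mul_le_mul_left this (by omega)
      have e1 : (2 * h + 1) * (i * L + j * M) = i * L' + j * M' + (i + j) * Q := by
        linear_combination i * hL + j * hM
      have e2 : (2 * h + 1) * (h * (L + M)) = h * (L' + M') + (2 * h) * Q := by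
        linear_combination h * hL + h * hM
      have e3 : (2 * h) * Q = (i + j) * Q + Q + c * Q := by rw [hc]; ring
      have e4 : 0 < h * (L' + M') := by positivity
      have : (2 * h + 1) * (i * L + j * M) < (2 * h + 1) * (h * (L + M)) := by
        rw [e1, e2, e3]
        have : 0 ≤ c * Q := Nat.zero_le _
        omega
      exact Nat.lt_of_mul_lt_mul_left this
    refine ⟨i * L + j * M, ?_, Nat.ModEq.rfl, Iff.rfl, ?_⟩
    · nlinarith
    · rw [Nat.choose_eq_zero_of_lt hr]; exact dvd_zero _
  · refine ⟨i * L + j * M, ?_, Nat.ModEq.rfl, Iff.rfl, hdvd i j heq (by omega)⟩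
    have : (2 * h) * (i * L + j * M) ≤ (2 * h) * Q := by
      have h1 : i * (2 * h * L) ≤ i * Q := by gcongr
      have h2 : j * (2 * h * M) ≤ j * Q := by gcongr
      have h3 : (2 * h) * Q = i * Q + j * Q := by rw [← heq]; ring
      rw [h3]
      nlinarith
    exact Nat.le_of_mul_le_mul_left this (by omega)
  · have e1 : (2 * h + 1) * (i * L + j * M) = i * L' + j * M' + (i + j) * Q := by
      linear_combination i * hL + j * hM
    obtain ⟨c, hc⟩ : ∃ c, i + j = 2 * h + 1 + c := ⟨i + j - (2 * h + 1), by omega⟩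
    have hpos : 0 < i * L' + j * M' := by
      rcases Nat.eq_zero_or_pos i with h0 | h0
      · have : 0 < j := by omega
        positivity
      · positivity
    have hQ : Q < i * L + j * M := by
      have : (2 * h + 1) * Q < (2 * h + 1) * (i * L + j * M) := by
        rw [e1, hc]
        have : 0 ≤ c * Q := Nat.zero_le _
        have : (2 * h + 1 + c) * Q = (2 * h + 1) * Q + c * Q := by ring
        omega
      exact Nat.lt_of_mul_lt_mul_left this
    have hi2 : i * L' ≤ Q := (Nat.mul_le_mul_right L' (by omega : i ≤ 2 * h)).trans hLQ'.le
    have hj2 : j * M' ≤ Q := (Nat.mul_le_mul_right M' (by omega : j ≤ 2 * h)).trans hMQ'.le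
    have hiL : i * L < Q := (Nat.mul_le_mul_right L (by omega : i ≤ 2 * h)).trans_lt hLQ
    have hjM : j * M < Q := (Nat.mul_le_mul_right M (by omega : j ≤ 2 * h)).trans_lt hMQ
    have hr : i * L + j * M - Q < h * (L + M) := by
      by_cases hmax : i + j = 4 * h
      · obtain rfl : i = 2 * h := by omega
        obtain rfl : j = 2 * h := by omega
        have : 2 * h * L + 2 * h * M = 2 * (h * (L + M)) := by ring
        omega
      · have e2 : (2 * h + 1) * (h * (L + M)) = h * (L' + M') + (2 * h) * Q := by
          linear_combination h * hL + h * hM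
        have e4 : 0 < h * (L' + M') := by positivity
        have e5 : (2 * h + 1) * (i * L + j * M - Q) + (2 * h + 1) * Q =
            i * L' + j * M' + (i + j) * Q := by
          rw [← e1, ← mul_add, Nat.sub_add_cancel hQ.le]
        obtain ⟨d, hd⟩ : ∃ d, 4 * h = i + j + 1 + d := ⟨4 * h - (i + j + 1), by omega⟩
        have e6 : (4 * h) * Q = (i + j) * Q + Q + d * Q := by rw [hd]; ring
        have e7 : (2 * h + 1) * Q = (2 * h) * Q + Q := by ring
        have e8 : (4 * h) * Q = (2 * h) * Q + (2 * h) * Q := by ring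
        have : (2 * h + 1) * (i * L + j * M - Q) < (2 * h + 1) * (h * (L + M)) := by
          rw [e2]
          have : 0 ≤ d * Q := Nat.zero_le _
          omega
        exact Nat.lt_of_mul_lt_mul_left this
    refine ⟨i * L + j * M - Q, by omega, ?_, by omega, ?_⟩
    · conv_lhs => rw [← Nat.sub_add_cancel hQ.le]
      simp [Nat.ModEq]
    · rw [Nat.choose_eq_zero_of_lt hr]; exact dvd_zero _

end Digits

section Exponents

variable {F : Type*} [Field F] [Fintype F]

lemma IsInversePermExponent.coprime {l : ℕ} (hl : IsInversePermExponent F l) :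
    l.Coprime (Fintype.card F - 1) := by
  obtain ⟨k, -, -, hlk⟩ := hl
  have h : (l * k).Coprime (Fintype.card F - 1) := by
    rw [Nat.Coprime, hlk.gcd_eq, Nat.gcd_one_left]
  exact h.coprime_mul_right

lemma monomialGraphMap_mul_prime_pow {K : Type*} [Field K] (p : ℕ) [Fact p.Prime] [CharP K p] (k c : ℕ) (x : K) :
    monomialGraphMap K (k * p ^ c) x = monomialGraphMap K k x ^ p ^ c := by
  simp only [monomialGraphMap, pow_mul, mul_pow, sub_pow_char_pow]

lemma IsInversePermExponent.mul_prime_pow {p e l m c : ℕ} [Fact p.Prime] [CharP F p]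
    (hF : Fintype.card F = p ^ e) (he : 1 ≤ e) (hl : IsInversePermExponent F l)
    (hm : m ≡ l * p ^ c [MOD Fintype.card F - 1]) : IsInversePermExponent F m := by
  obtain ⟨k, hk, hbij, hlk⟩ := hl
  have hp : 0 < p := (Fact.out : p.Prime).pos
  refine ⟨k * p ^ ((e - 1) * c), Nat.mul_pos hk (by positivity), ?_, ?_⟩
  · have h : monomialGraphMap F (k * p ^ ((e - 1) * c)) =
        iterateFrobenius F p ((e - 1) * c) ∘ monomialGraphMap F k := by
      funext x
      simp [monomialGraphMap_mul_prime_pow p, iterateFrobenius_def]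
    rw [h]
    exact (bijective_iterateFrobenius F p _).comp hbij
  · have hq : p ^ e ≡ 1 [MOD Fintype.card F - 1] := by
      have h1 : 1 ≤ p ^ e := Nat.one_le_pow _ _ hp
      rw [hF]
      exact ((Nat.modEq_iff_dvd' h1).2 dvd_rfl).symm
    calc m * (k * p ^ ((e - 1) * c))
        ≡ l * p ^ c * (k * p ^ ((e - 1) * c)) [MOD Fintype.card F - 1] := hm.mul_right _
      _ = l * k * (p ^ e) ^ c := by
        obtain ⟨d, rfl⟩ : ∃ d, e = d + 1 := ⟨e - 1, by omega⟩
        simp only [Nat.add_sub_cancel]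
        ring
      _ ≡ 1 * 1 ^ c [MOD Fintype.card F - 1] := hlk.mul (hq.pow c)
      _ = 1 := by simp

/-- The leading base-`p` digit of the exponent is at most one. -/
lemma IsInversePermExponent.mul_lt {p l : ℕ} [Fact p.Prime] [CharP F p] (hp : Odd p)
    (hpF : p ≤ Fintype.card F) (hl : IsInversePermExponent F l) (hl0 : 0 < l)
    (hlQ : l < Fintype.card F - 1) : p * l < 2 * (Fintype.card F - 1) := by
  have hco := hl.coprime
  have hp2 := (Fact.out : p.Prime).two_le
  by_contra! hge
  set Q := Fintype.card F - 1 with hQ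
  have hl1 : l ≠ 1 := by rintro rfl; obtain ⟨h, rfl⟩ := hp; omega
  set a := Q / l with ha
  have hal : l * a ≤ Q := Nat.mul_div_le Q l
  have ha1 : 0 < a := Nat.div_pos hlQ.le hl0
  have hsucc : Q < l * (a + 1) := Nat.lt_mul_div_succ Q hl0
  have hne : l * a ≠ Q := by
    intro h
    apply hl1
    have h2 : l ∣ Nat.gcd l Q := Nat.dvd_gcd dvd_rfl ⟨a, h.symm⟩
    rw [hco] at h2
    exact Nat.dvd_one.1 h2
  have h2a : 2 * a < p := by
    have h3 : l * (2 * a) ≤ l * p := by nlinarith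
    have h4 := Nat.le_of_mul_le_mul_left h3 hl0
    obtain ⟨h, rfl⟩ := hp
    omega
  have hsum := hl.sum_eq_zero (s := a) (n := l * a) (by positivity) (by omega) Nat.ModEq.rfl
  have hexp : ∀ w : F, w ^ (Q - l * a) * ((w + 1) ^ l - 1) ^ (2 * a) =
      ∑ i ∈ range (2 * a + 1), (-1) ^ (i + 2 * a) * ((2 * a).choose i : F) *
        (w ^ (Q - l * a) * (w + 1) ^ (l * i)) := by
    intro w
    rw [sub_pow, mul_sum]
    refine sum_congr rfl fun i _ => ?_
    rw [one_pow, pow_mul]; ring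
  simp_rw [← hQ, hexp] at hsum
  rw [sum_comm] at hsum
  simp_rw [← mul_sum] at hsum
  rw [sum_eq_single_of_mem a (by simp; omega)] at hsum
  · rw [sum_pow_mul_add_one_pow_of_modEq (by positivity) (by omega) hal Nat.ModEq.rfl Iff.rfl,
      Nat.choose_self] at hsum
    have hch : ((2 * a).choose a : F) = 0 := by simpa using hsum
    rw [CharP.cast_eq_zero_iff F p] at hch
    have hfac : p ∣ (2 * a).factorial := by
      rw [← Nat.choose_mul_factorial_mul_factorial (show a ≤ 2 * a by omega), mul_assoc]
      exact hch.mul_right _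
    have := ((Fact.out : p.Prime).dvd_factorial).1 hfac
    omega
  · intro i hi hia
    rw [mem_range] at hi
    rcases lt_or_gt_of_ne hia with h | h
    · have hlt : l * i < l * a := Nat.mul_lt_mul_of_pos_left h hl0
      rw [sum_pow_mul_add_one_pow_of_modEq (by positivity) (by omega) (r := l * i) (by omega)
        Nat.ModEq.rfl Iff.rfl, Nat.choose_eq_zero_of_lt hlt]
      simp
    · have h5 : Q < l * i := hsucc.trans_le (Nat.mul_le_mul_left l h)
      have h6 : l * i ≤ l * a + l * a := by nlinarith
      have h7 : l * i ≡ l * i - Q [MOD Q] := by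
        conv_lhs => rw [← Nat.sub_add_cancel h5.le]
        simp [Nat.ModEq]
      have h8 : l * i - Q < l * a := by omega
      rw [sum_pow_mul_add_one_pow_of_modEq (by positivity) (by omega) (by omega) h7 (by omega),
        Nat.choose_eq_zero_of_lt h8]
      simp

lemma sub_one_pow_prime_sub_one {K : Type*} [Field K] (p : ℕ) [Fact p.Prime] [CharP K p] (y : K) :
    (y - 1) ^ (p - 1) = ∑ i ∈ range p, y ^ i := by
  have hp := (Fact.out : p.Prime).two_le
  by_cases hy : y = 1
  · subst hy
    simp [show p - 1 ≠ 0 by omega]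
  · have hy' : y - 1 ≠ 0 := sub_ne_zero.2 hy
    apply mul_right_cancel₀ hy'
    rw [geom_sum_mul, ← pow_succ, Nat.sub_add_cancel (by omega), sub_pow_char, one_pow]

lemma sub_one_pow_prime_sub_one_mul {K : Type*} [Field K] (p b : ℕ) [Fact p.Prime] [CharP K p] (y : K) :
    (y - 1) ^ ((p - 1) + (p - 1) * p ^ b) =
      ∑ x ∈ range p ×ˢ range p, y ^ (x.1 + x.2 * p ^ b) := by
  rw [pow_add, mul_comm (p - 1) (p ^ b), pow_mul _ (p ^ b), sub_pow_char_pow, one_pow,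
    sub_one_pow_prime_sub_one p, sub_one_pow_prime_sub_one p, sum_mul_sum, sum_product]
  refine sum_congr rfl fun i _ => sum_congr rfl fun j _ => ?_
  rw [pow_add, mul_comm j, pow_mul]

end Exponents

section RepeatingExpansion

lemma pow_mul_eq_add_sum_digits {p Q : ℕ} {R τ : ℕ → ℕ} (hrec : ∀ c, p * R c = R (c + 1) + Q * τ c)
    (d c : ℕ) :
    p ^ d * R c = R (c + d) + Q * ∑ t ∈ range d, τ (c + d - 1 - t) * p ^ t := by
  induction d generalizing c with
  | zero => simp
  | succ d ih =>
    rw [sum_range_succ, pow_succ, mul_assoc, hrec c, mul_add, ih (c + 1)]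
    have h1 : c + (d + 1) - 1 - d = c := by omega
    have h2 : ∀ t, c + 1 + d - 1 - t = c + (d + 1) - 1 - t := fun t => by omega
    simp only [h1, h2]
    rw [show c + 1 + d = c + (d + 1) by ring]
    ring

/-- The digits of a repeating expansion of period `e`. -/
lemma eq_sum_digits_of_periodic {p e Q : ℕ} {R τ : ℕ → ℕ} (hQ : 0 < Q) (hpe : p ^ e = Q + 1)
    (hrec : ∀ c, p * R c = R (c + 1) + Q * τ c) (hR : ∀ c, R (c + e) = R c) (c : ℕ) :
    R c = ∑ t ∈ range e, τ (c + e - 1 - t) * p ^ t := by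
  have h := pow_mul_eq_add_sum_digits hrec e c
  rw [hR, hpe, add_mul, one_mul, add_comm] at h
  exact Nat.eq_of_mul_eq_mul_left hQ (Nat.add_left_cancel h)

lemma eq_add_of_le_add_of_periodic {e b : ℕ} {τ : ℕ → ℕ} (he : 1 ≤ e)
    (hτ : Function.Periodic τ e) (h : ∀ x, τ x ≤ τ (x + b)) (x : ℕ) : τ (x + b) = τ x := by
  refine le_antisymm ?_ (h x)
  have h1 : ∀ m, τ (x + b) ≤ τ (x + (m + 1) * b) := by
    intro m
    induction m with
    | zero => simp
    | succ m ih => exact ih.trans ((h _).trans_eq (by congr 1; ring))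
  have h2 := h1 (e - 1)
  rw [Nat.sub_add_cancel he, mul_comm e b, ← smul_eq_mul, hτ.nsmul b x] at h2
  exact h2

lemma eq_add_of_add_le_of_periodic {e b : ℕ} {τ : ℕ → ℕ} (he : 1 ≤ e)
    (hτ : Function.Periodic τ e) (h : ∀ x, τ (x + b) ≤ τ x) (x : ℕ) : τ (x + b) = τ x := by
  refine le_antisymm (h x) ?_
  have h1 : ∀ m, τ (x + (m + 1) * b) ≤ τ (x + b) := by
    intro m
    induction m with
    | zero => simp
    | succ m ih => exact (Eq.trans_le (by congr 1; ring) (h _)).trans ih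
  have h2 := h1 (e - 1)
  rw [Nat.sub_add_cancel he, mul_comm e b, ← smul_eq_mul, hτ.nsmul b x] at h2
  exact h2

lemma exists_lt_reflected_eq {e c : ℕ} {τ : ℕ → ℕ} (he : 1 ≤ e) (hτ : Function.Periodic τ e)
    (x : ℕ) : ∃ t < e, ∀ b, τ (c + b + e - 1 - t) = τ (x + b) := by
  refine ⟨(c + e - 1 + (e - 1) * x) % e, Nat.mod_lt _ he, fun b => ?_⟩
  set t := (c + e - 1 + (e - 1) * x) % e with ht
  have hte : t < e := Nat.mod_lt _ he
  have h : c + b + e - 1 - t ≡ x + b [MOD e] := by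
    apply Nat.ModEq.add_right_cancel' t
    calc c + b + e - 1 - t + t = b + (c + e - 1) := by omega
      _ ≡ b + (c + e - 1) + e * x [MOD e] := by simp [Nat.ModEq]
      _ = x + b + (c + e - 1 + (e - 1) * x) := by
        obtain ⟨d, rfl⟩ : ∃ d, e = d + 1 := ⟨e - 1, by omega⟩
        simp only [Nat.add_sub_cancel, ← Nat.add_assoc]
        ring
      _ ≡ x + b + t [MOD e] := (Nat.mod_modEq _ _).symm.add_left _
  rw [← hτ.map_mod_nat, h, hτ.map_mod_nat]

/-- Two rotations of a zero-one digit pattern: off the diagonal the binomial coefficients of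
their combinations with digit sum `2 * h` vanish modulo `p = 2 * h + 1`. -/
lemma dvd_choose_of_rotation_ne {p e h Q b c : ℕ} {R τ : ℕ → ℕ} (hp : p.Prime)
    (hph : p = 2 * h + 1) (hQ : 0 < Q) (he : 1 ≤ e) (hpe : p ^ e = Q + 1)
    (hrec : ∀ c, p * R c = R (c + 1) + Q * τ c) (hR : ∀ c, R (c + e) = R c)
    (hτ : Function.Periodic τ e) (hτ1 : ∀ c, τ c ≤ 1) (hne : R (c + b) ≠ R c)
    {i j : ℕ} (hij : i + j = 2 * h) (hi : i ≠ h) :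
    p ∣ (i * R c + j * R (c + b)).choose (h * (R c + R (c + b))) := by
  have hsum := eq_sum_digits_of_periodic hQ hpe hrec hR
  have hτb : ∃ x, τ (x + b) ≠ τ x := by
    by_contra! hall
    apply hne
    rw [hsum c, hsum (c + b)]
    refine sum_congr rfl fun t ht => ?_
    rw [mem_range] at ht
    rw [← hall (c + e - 1 - t)]
    congr 2
    omega
  have hx : ∃ x, i * τ x + j * τ (x + b) < h * (τ x + τ (x + b)) := by
    obtain ⟨y, hy⟩ := hτb
    rcases lt_or_gt_of_ne hi with hlt | hgt
    · obtain ⟨x, hx⟩ : ∃ x, τ (x + b) < τ x := by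
        by_contra! hall
        exact hy (eq_add_of_le_add_of_periodic he hτ hall y)
      refine ⟨x, ?_⟩
      have := hτ1 x
      rw [show τ x = 1 by omega, show τ (x + b) = 0 by omega]
      omega
    · obtain ⟨x, hx⟩ : ∃ x, τ x < τ (x + b) := by
        by_contra! hall
        exact hy (eq_add_of_add_le_of_periodic he hτ hall y)
      refine ⟨x, ?_⟩
      have := hτ1 (x + b)
      rw [show τ x = 0 by omega, show τ (x + b) = 1 by omega]
      omega
  obtain ⟨x, hx⟩ := hx
  obtain ⟨t, hte, ht⟩ := exists_lt_reflected_eq (c := c) he hτ x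
  have ht0 := ht 0
  simp only [add_zero] at ht0
  have e1 : i * R c + j * R (c + b) = ∑ t ∈ range e,
      (i * τ (c + e - 1 - t) + j * τ (c + b + e - 1 - t)) * p ^ t := by
    rw [hsum c, hsum (c + b), mul_sum, mul_sum, ← sum_add_distrib]
    exact sum_congr rfl fun t _ => by ring
  have e2 : h * (R c + R (c + b)) = ∑ t ∈ range e,
      (h * (τ (c + e - 1 - t) + τ (c + b + e - 1 - t))) * p ^ t := by
    rw [hsum c, hsum (c + b), ← sum_add_distrib, mul_sum]
    exact sum_congr rfl fun t _ => by ring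
  rw [e1, e2]
  refine dvd_choose_of_digit_lt hp e _ _ (fun t => ?_) (fun t => ?_) hte (by
    rw [ht0, ht b]; exact hx)
  · have h1 := Nat.mul_le_mul_left i (hτ1 (c + e - 1 - t))
    have h2 := Nat.mul_le_mul_left j (hτ1 (c + b + e - 1 - t))
    omega
  · have h1 := Nat.mul_le_mul_left h (hτ1 (c + e - 1 - t))
    have h2 := Nat.mul_le_mul_left h (hτ1 (c + b + e - 1 - t))
    rw [mul_add]
    omega

end RepeatingExpansion

section Main

variable {F : Type*} [Field F] [Fintype F]

/-- The exponent cannot have two rotations `L` and `M` with leading digit one whose combinations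
off the diagonal have vanishing binomial coefficients. -/
lemma IsInversePermExponent.false_of_two_digits {p h b L M L' M' : ℕ} [Fact p.Prime] [CharP F p]
    (hph : p = 2 * h + 1) (hh : 1 ≤ h) (hgood : IsInversePermExponent F L)
    (hLM : M ≡ L * p ^ b [MOD Fintype.card F - 1])
    (hL : p * L = L' + (Fintype.card F - 1)) (hM : p * M = M' + (Fintype.card F - 1))
    (hL0 : 0 < L) (hL0' : 0 < L') (hM0' : 0 < M')
    (hLQ : (p - 1) * L < Fintype.card F - 1) (hMQ : (p - 1) * M < Fintype.card F - 1)
    (hLQ' : (p - 1) * L' < Fintype.card F - 1) (hMQ' : (p - 1) * M' < Fintype.card F - 1)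
    (hdvd : ∀ i j, i + j = 2 * h → i ≠ h → p ∣ (i * L + j * M).choose (h * (L + M))) :
    False := by
  set Q := Fintype.card F - 1 with hQ
  set n := h * (L + M) with hn
  have hn0 : 0 < n := by positivity
  have hnQ : n < Q := by
    have : (p - 1) * L + (p - 1) * M = 2 * n := by
      rw [hn, show p - 1 = 2 * h by omega]; ring
    omega
  have hs : ∀ i j, L * (i + j * p ^ b) ≡ i * L + j * M [MOD Q] := by
    intro i j
    calc L * (i + j * p ^ b) = i * L + j * (L * p ^ b) := by ring
      _ ≡ i * L + j * M [MOD Q] := (hLM.symm.mul_left j).add_left _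
  have hsn : L * (h + h * p ^ b) ≡ n [MOD Q] := by
    rw [hn, mul_add h]; exact hs h h
  have hsum := hgood.sum_eq_zero hn0 hnQ hsn
  have hexp : ∀ w : F, w ^ (Q - n) * ((w + 1) ^ L - 1) ^ (2 * (h + h * p ^ b)) =
      ∑ x ∈ range p ×ˢ range p, w ^ (Q - n) * (w + 1) ^ (L * (x.1 + x.2 * p ^ b)) := by
    intro w
    rw [show 2 * (h + h * p ^ b) = (p - 1) + (p - 1) * p ^ b by
      rw [show p - 1 = 2 * h by omega]; ring, sub_one_pow_prime_sub_one_mul p, mul_sum]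
    exact sum_congr rfl fun x _ => by rw [pow_mul]
  simp_rw [← hQ, hexp] at hsum
  rw [sum_comm] at hsum
  have hM0 : 0 < M := by
    rcases Nat.eq_zero_or_pos M with h0 | h0
    · subst h0; omega
    · exact h0
  have hzero : ∀ (i j : ℕ), L * (i + j * p ^ b) = 0 ↔ i * L + j * M = 0 := by
    intro i j
    have hp0 : p ≠ 0 := by omega
    simp [hL0.ne', hM0.ne', hp0]
  rw [sum_eq_single_of_mem (h, h) (by simp; omega)] at hsum
  · rw [sum_pow_mul_add_one_pow_of_modEq hn0 hnQ hnQ.le hsn ?_, Nat.choose_self] at hsum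
    · simp at hsum
    · rw [hzero, hn, mul_add]
  · rintro ⟨i, j⟩ hmem hne
    rw [mem_product, mem_range, mem_range] at hmem
    obtain ⟨r, hrQ, hr, hr0, hrd⟩ := exists_residue_dvd_choose hph hh hL hM hL0' hM0' hLQ hMQ hLQ'
      hMQ' hdvd hmem.1 hmem.2 (by simpa using hne)
    rw [sum_pow_mul_add_one_pow_of_modEq hn0 hnQ hrQ ((hs i j).trans hr) ((hzero i j).trans hr0),
      (CharP.cast_eq_zero_iff F p _).2 hrd, neg_zero]

/-- An inverse exponent of a permutation `A_k` is a power of the characteristic. -/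
lemma IsInversePermExponent.eq_prime_pow {p e l : ℕ} [Fact p.Prime] [CharP F p] (hp : Odd p)
    (hF : Fintype.card F = p ^ e) (he : 1 ≤ e) (hl : IsInversePermExponent F l)
    (hlQ : l < Fintype.card F - 1) : ∃ j < e, l = p ^ j := by
  have hpp : p.Prime := Fact.out
  obtain ⟨h, hph⟩ := id hp
  have hh : 1 ≤ h := by have := hpp.two_le; omega
  have hpF : p ≤ Fintype.card F := by rw [hF]; exact Nat.le_self_pow (by omega) p
  set Q := Fintype.card F - 1 with hQ
  have hpe : p ^ e = Q + 1 := by omega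
  have hQ2 : 1 < Q := by omega
  set R : ℕ → ℕ := fun c => l * p ^ c % Q with hRdef
  set τ : ℕ → ℕ := fun c => p * R c / Q with hτdef
  have hRmod : ∀ c, R c ≡ l * p ^ c [MOD Q] := fun c => Nat.mod_modEq _ _
  have hgood : ∀ c, IsInversePermExponent F (R c) := fun c => hl.mul_prime_pow hF he (hRmod c)
  have hRQ : ∀ c, R c < Q := fun c => Nat.mod_lt _ (by omega)
  have hR0 : ∀ c, 0 < R c := by
    intro c
    by_contra h0
    have hco := (hgood c).coprime
    rw [show R c = 0 by omega, Nat.coprime_zero_left] at hco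
    omega
  have hq1 : p ^ e ≡ 1 [MOD Q] := by rw [hpe]; simp [Nat.ModEq]
  have hRper : ∀ c, R (c + e) = R c := by
    intro c
    have : l * p ^ (c + e) ≡ l * p ^ c [MOD Q] := by
      rw [pow_add, ← mul_assoc]
      simpa using hq1.mul_left (l * p ^ c)
    exact this
  have hτper : Function.Periodic τ e := fun c => by simp only [hτdef, hRper]
  have hrec : ∀ c, p * R c = R (c + 1) + Q * τ c := by
    intro c
    have h1 : R (c + 1) = p * R c % Q := by
      have : l * p ^ (c + 1) ≡ p * R c [MOD Q] := by
        calc l * p ^ (c + 1) = p * (l * p ^ c) := by ring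
          _ ≡ p * R c [MOD Q] := (hRmod c).symm.mul_left p
      exact this
    rw [h1, hτdef]
    exact (Nat.mod_add_div _ _).symm
  have hτ1 : ∀ c, τ c ≤ 1 := by
    intro c
    have := (hgood c).mul_lt hp hpF (hR0 c) (hRQ c)
    exact Nat.le_of_lt_succ (Nat.div_lt_of_lt_mul (this.trans_eq (mul_comm _ _)))
  have hdig := eq_sum_digits_of_periodic (by omega) hpe hrec hRper
  have hgeom : (p - 1) * ∑ t ∈ range e, p ^ t = Q := by
    rw [mul_comm, geom_sum_mul_of_one_le hpp.one_le, hpe, Nat.add_sub_cancel]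
  have hRle : ∀ c, (p - 1) * R c ≤ Q := by
    intro c
    rw [← hgeom, hdig c]
    gcongr with t ht
    simpa using Nat.mul_le_mul_right (p ^ t) (hτ1 (c + e - 1 - t))
  have hsep : ∀ c b, 0 < b → b < e → τ c = 1 → τ (c + b) = 1 → False := by
    intro c b hb hbe h1 h2
    have hRlt : ∀ c, (p - 1) * R c < Q := by
      intro c
      refine lt_of_le_of_ne (hRle c) fun heq => ?_
      have h3 : R c ∣ Nat.gcd (R c) Q := Nat.dvd_gcd dvd_rfl ⟨p - 1, by rw [mul_comm, heq]⟩
      rw [(hgood c).coprime, Nat.dvd_one] at h3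
      rw [h3, mul_one] at heq
      have h4 : p ^ 1 < p ^ e := Nat.pow_lt_pow_right hpp.one_lt (by omega)
      rw [pow_one] at h4
      omega
    have hRb : R (c + b) ≡ R c * p ^ b [MOD Q] := by
      calc R (c + b) ≡ l * p ^ (c + b) [MOD Q] := hRmod _
        _ = l * p ^ c * p ^ b := by ring
        _ ≡ R c * p ^ b [MOD Q] := (hRmod c).symm.mul_right _
    have hne : R (c + b) ≠ R c := by
      intro heq
      rw [heq] at hRb
      have h3 : 1 ≡ p ^ b [MOD Q] := by
        apply Nat.ModEq.cancel_left_of_coprime (c := R c)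
        · exact (hgood c).coprime.symm
        · simpa using hRb
      have h4 : 1 < p ^ b := Nat.one_lt_pow hb.ne' hpp.one_lt
      have h5 : p ^ b < p ^ e := Nat.pow_lt_pow_right hpp.one_lt hbe
      have h6 := Nat.le_of_dvd (by omega) ((Nat.modEq_iff_dvd' h4.le).1 h3)
      omega
    have hL := hrec c
    have hM := hrec (c + b)
    rw [h1, mul_one] at hL
    rw [h2, mul_one] at hM
    exact (hgood c).false_of_two_digits hph hh hRb hL hM (hR0 _) (hR0 _) (hR0 _) (hRlt _) (hRlt _)
      (hRlt _) (hRlt _) fun i j hij hi =>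
        dvd_choose_of_rotation_ne hpp hph (by omega) he hpe hrec hRper hτper hτ1 hne hij hi
  have hl0 : l = ∑ t ∈ range e, τ (e - 1 - t) * p ^ t := by
    have hd0 := hdig 0
    rwa [show R 0 = l by simp [hRdef, Nat.mod_eq_of_lt hlQ], zero_add] at hd0
  obtain ⟨t, ht, htne⟩ : ∃ t ∈ range e, τ (e - 1 - t) ≠ 0 := by
    by_contra! hall
    have : l = 0 := by
      rw [hl0]
      exact Finset.sum_eq_zero fun t ht => by rw [hall t ht, zero_mul]
    have h0 := hR0 0
    simp [hRdef, this] at h0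
  rw [mem_range] at ht
  have hone : τ (e - 1 - t) = 1 := by have := hτ1 (e - 1 - t); omega
  refine ⟨t, ht, ?_⟩
  rw [hl0, sum_eq_single_of_mem t (mem_range.2 ht), hone, one_mul]
  intro u hu hut
  rw [mem_range] at hu
  suffices τ (e - 1 - u) = 0 by rw [this, zero_mul]
  by_contra hu0
  have huone : τ (e - 1 - u) = 1 := by have := hτ1 (e - 1 - u); omega
  rcases lt_or_gt_of_ne hut with hlt | hgt
  · exact hsep (e - 1 - t) (t - u) (by omega) (by omega) hone
      (by rw [show e - 1 - t + (t - u) = e - 1 - u by omega]; exact huone)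
  · exact hsep (e - 1 - u) (u - t) (by omega) (by omega) huone
      (by rw [show e - 1 - u + (u - t) = e - 1 - t by omega]; exact hone)

lemma coprime_card_sub_one_of_injective {k : ℕ} (hk : 1 ≤ k)
    (hinj : Function.Injective (monomialGraphMap F k)) : k.Coprime (Fintype.card F - 1) := by
  have hroot : ∀ y : F, y ^ k = 1 → y = 1 := by
    intro y hy
    by_contra hy1
    have hu : y - 1 ≠ 0 := sub_ne_zero.2 hy1
    have h : monomialGraphMap F k (y - 1)⁻¹ = monomialGraphMap F k 0 := by
      have h3 : (y - 1)⁻¹ + 1 = (y - 1)⁻¹ * y := by field_simp; ring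
      rw [monomialGraphMap, h3, mul_pow, hy]
      simp [monomialGraphMap, show k ≠ 0 by omega]
    exact hu (inv_eq_zero.1 (hinj h))
  obtain ⟨g, hg⟩ := IsCyclic.exists_generator (α := Fˣ)
  have hord : orderOf g = Fintype.card F - 1 := by
    rw [orderOf_eq_card_of_forall_mem_zpowers hg, Nat.card_units, Nat.card_eq_fintype_card]
  set Q := Fintype.card F - 1 with hQ
  have hQ0 : 0 < Q := by have := Fintype.one_lt_card (α := F); omega
  set d := Nat.gcd k Q with hd
  obtain ⟨a, ha⟩ : d ∣ k := Nat.gcd_dvd_left k Q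
  obtain ⟨c, hc⟩ : d ∣ Q := Nat.gcd_dvd_right k Q
  have h1 : (g ^ c) ^ k = 1 := by
    rw [ha, ← pow_mul, ← mul_assoc, mul_comm c d, ← hc, pow_mul, ← hord, pow_orderOf_eq_one,
      one_pow]
  have h2 : g ^ c = 1 := by
    apply Units.ext
    apply hroot
    rw [← Units.val_pow_eq_pow_val, h1, Units.val_one]
  have h3 : Q ∣ c := hord ▸ orderOf_dvd_of_pow_eq_one h2
  have hc0 : 0 < c := Nat.pos_of_ne_zero (by rintro rfl; omega)
  have h4 := Nat.le_of_dvd hc0 h3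
  have hd0 : 0 < d := Nat.gcd_pos_of_pos_left _ hk
  show d = 1
  nlinarith

end Main

theorem stmt_8 (p e k : ℕ) (hp : p.Prime) (hodd : Odd p) (he : 1 ≤ e)
    (hk1 : 1 ≤ k) (hk2 : k ≤ p ^ e - 1)
    (F : Type*) [Field F] [Fintype F] (hF : Fintype.card F = p ^ e) :
    (Function.Bijective (fun x : F => x ^ k * ((x + 1) ^ k - x ^ k)) ↔ ∃ j : ℕ, k = p ^ j) ∧
    (Function.Bijective (fun x : F => x ^ k * ((x + 1) ^ k - x ^ k)) ↔
      Function.Injective (fun x : F => x ^ k * ((x + 1) ^ k - x ^ k))) := by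
  have : Fact p.Prime := ⟨hp⟩
  have : CharP F p := charP_of_card_eq_prime_pow hF
  refine ⟨⟨fun hbij => ?_, ?_⟩, Finite.injective_iff_bijective.symm⟩
  · change Function.Bijective (monomialGraphMap F k) at hbij
    have hp3 : 3 ≤ p := by have := hp.two_le; obtain ⟨h, rfl⟩ := hodd; omega
    have hpe : p ≤ p ^ e := Nat.le_self_pow (by omega) p
    have hQ2 : 1 < p ^ e - 1 := by omega
    have hco := coprime_card_sub_one_of_injective hk1 hbij.1
    rw [hF] at hco
    obtain ⟨l, hlQ, hkl⟩ := Nat.exists_mul_mod_eq_one_of_coprime hco hQ2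
    have hkl' : k * l ≡ 1 [MOD p ^ e - 1] := by rw [Nat.ModEq, hkl, Nat.mod_eq_of_lt hQ2]
    have hl : IsInversePermExponent F l := ⟨k, hk1, hbij, by rw [hF, mul_comm]; exact hkl'⟩
    obtain ⟨j, hj, rfl⟩ := hl.eq_prime_pow hodd hF he (by rwa [hF])
    have hkj : k ≡ p ^ (e - j) [MOD p ^ e - 1] := by
      have hq : 1 ≡ p ^ e [MOD p ^ e - 1] := (Nat.modEq_iff_dvd' (by omega)).2 dvd_rfl
      calc k = k * 1 := (mul_one k).symm
        _ ≡ k * p ^ e [MOD p ^ e - 1] := hq.mul_left k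
        _ = k * p ^ j * p ^ (e - j) := by rw [mul_assoc, ← pow_add, Nat.add_sub_cancel' hj.le]
        _ ≡ 1 * p ^ (e - j) [MOD p ^ e - 1] := hkl'.mul_right _
        _ = p ^ (e - j) := one_mul _
    rcases Nat.eq_zero_or_pos j with rfl | hj0
    · refine ⟨0, ?_⟩
      rw [pow_zero, mul_one] at hkl'
      rw [pow_zero]
      rcases hk2.lt_or_eq with h | h
      · exact hkl'.eq_of_lt_of_lt h hQ2
      · rw [h, Nat.ModEq, Nat.mod_self, Nat.mod_eq_of_lt hQ2] at hkl'
        omega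
    · refine ⟨e - j, ?_⟩
      have h1 : p ^ (e - j) * 3 ≤ p ^ e := by
        calc p ^ (e - j) * 3 ≤ p ^ (e - j) * p ^ j := by
              gcongr
              exact hp3.trans (Nat.le_self_pow (by omega) p)
          _ = p ^ e := by rw [← pow_add, Nat.sub_add_cancel hj.le]
      have h2 : 0 < p ^ (e - j) := by positivity
      have h3 : p ^ (e - j) < p ^ e - 1 := by omega
      rcases hk2.lt_or_eq with h | h
      · exact hkj.eq_of_lt_of_lt h h3
      · rw [h, Nat.ModEq, Nat.mod_self, Nat.mod_eq_of_lt h3] at hkj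
        omega
  · rintro ⟨j, rfl⟩
    have h : (fun x : F => x ^ p ^ j * ((x + 1) ^ p ^ j - x ^ p ^ j)) = iterateFrobenius F p j := by
      funext x
      rw [iterateFrobenius_def, add_pow_char_pow, one_pow, add_sub_cancel_left, mul_one]
    rw [h]
    exact bijective_iterateFrobenius F p j
end
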